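/- For a complex number s, the double series ∑_{j ≥ 1} ∑_{k ≥ 1} (jk(j+k)(j+2k)/6)^{−s} converges absolutely if and only if Re(s) > 1/2, and the function s ↦ ∑_{j,k ≥ 1} (jk(j+k)(j+2k)/6)^{−s} is holomorphic on the half-plane {s ∈ ℂ : Re(s) > 1/2}. -/

import Mathlib

open Complex Filter

/-- The dimension jk(j+k)(j+2k)/6 of the irreducible so(5)-representation indexed by
(j,k) = (p.1+1, p.2+1), as a complex number. -/
noncomputable def so5dim (p : ℕ × ℕ) : ℂ :=
  (((p.1 + 1) * (p.2 + 1) * ((p.1 + 1) + (p.2 + 1)) * ((p.1 + 1) + 2 * (p.2 + 1)) : ℕ) : ℂ) / 6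

/-- The dimension `so5dim p` as a real number. -/
noncomputable def so5dimReal (p : ℕ × ℕ) : ℝ :=
  ((p.1 + 1 : ℝ) * (p.2 + 1) * ((p.1 + 1) + (p.2 + 1)) * ((p.1 + 1) + 2 * (p.2 + 1))) / 6

theorem so5dim_eq_ofReal (p : ℕ × ℕ) : so5dim p = (so5dimReal p : ℂ) := by
  simp [so5dim, so5dimReal]

theorem sq_div_three_le_so5dimReal (p : ℕ × ℕ) :
    (((p.1 : ℝ) + 1) * (p.2 + 1)) ^ 2 / 3 ≤ so5dimReal p := by
  have ha : (0 : ℝ) < p.1 + 1 := by positivity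
  have hb : (0 : ℝ) < p.2 + 1 := by positivity
  unfold so5dimReal
  generalize (p.1 : ℝ) + 1 = a at *
  generalize (p.2 : ℝ) + 1 = b at *
  have h : 0 ≤ a * b * (a ^ 2 + a * b + 2 * b ^ 2) := by positivity
  linarith

theorem one_le_so5dimReal (p : ℕ × ℕ) : 1 ≤ so5dimReal p := by
  have ha : (1 : ℝ) ≤ p.1 + 1 := by simp
  have hb : (1 : ℝ) ≤ p.2 + 1 := by simp
  unfold so5dimReal
  generalize (p.1 : ℝ) + 1 = a at *
  generalize (p.2 : ℝ) + 1 = b at *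
  have hab : 1 * 1 * (1 + 1) * (1 + 2 * 1) ≤ a * b * (a + b) * (a + 2 * b) := by gcongr
  linarith

theorem so5dimReal_pos (p : ℕ × ℕ) : 0 < so5dimReal p :=
  one_pos.trans_le (one_le_so5dimReal p)

theorem so5dimReal_le_pow_four {p : ℕ × ℕ} (hp : p.2 ≤ p.1) :
    so5dimReal p ≤ ((p.1 : ℝ) + 1) ^ 4 := by
  have ha : (0 : ℝ) < p.1 + 1 := by positivity
  have hb : (0 : ℝ) < p.2 + 1 := by positivity
  have hba : (p.2 : ℝ) + 1 ≤ p.1 + 1 := by gcongr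
  unfold so5dimReal
  generalize (p.1 : ℝ) + 1 = a at *
  generalize (p.2 : ℝ) + 1 = b at *
  have hab : a * b * (a + b) * (a + 2 * b) ≤ a * a * (a + a) * (a + 2 * a) := by gcongr
  linarith

theorem norm_so5dim_cpow_neg (p : ℕ × ℕ) (s : ℂ) :
    ‖so5dim p ^ (-s)‖ = so5dimReal p ^ (-s.re) := by
  rw [so5dim_eq_ofReal, norm_cpow_eq_rpow_re_of_pos (so5dimReal_pos p), neg_re]

theorem summable_so5dimReal_rpow_neg {σ : ℝ} (hσ : 1 / 2 < σ) :
    Summable fun p : ℕ × ℕ => so5dimReal p ^ (-σ) := by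
  have hbase : Summable fun n : ℕ => ((n : ℝ) + 1) ^ (-(2 * σ)) := by
    have h := (summable_nat_add_iff 1).2
      (Real.summable_nat_rpow (p := -(2 * σ)) |>.2 (by linarith))
    simpa using h
  have hprod := (hbase.mul_of_nonneg hbase (fun n => by positivity)
    (fun n => by positivity)).mul_left ((3 : ℝ) ^ σ)
  refine hprod.of_nonneg_of_le (fun p => Real.rpow_nonneg (so5dimReal_pos p).le _) fun p => ?_
  have ha : (0 : ℝ) < p.1 + 1 := by positivity
  have hb : (0 : ℝ) < p.2 + 1 := by positivity
  calc so5dimReal p ^ (-σ)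
      ≤ ((((p.1 : ℝ) + 1) * (p.2 + 1)) ^ 2 / 3) ^ (-σ) :=
        Real.rpow_le_rpow_of_nonpos (by positivity) (sq_div_three_le_so5dimReal p) (by linarith)
    _ = 3 ^ σ * (((p.1 : ℝ) + 1) ^ (-(2 * σ)) * ((p.2 : ℝ) + 1) ^ (-(2 * σ))) := by
        rw [Real.div_rpow (by positivity) (by norm_num), ← Real.rpow_natCast,
          ← Real.rpow_mul (by positivity), Real.mul_rpow ha.le hb.le,
          Real.rpow_neg (by norm_num : (0 : ℝ) ≤ 3), div_inv_eq_mul, mul_comm]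
        push_cast
        rw [mul_neg]

theorem not_summable_so5dimReal_rpow_neg {σ : ℝ} (hσ : σ ≤ 1 / 2) :
    ¬ Summable fun p : ℕ × ℕ => so5dimReal p ^ (-σ) := by
  intro h
  let e : (Σ n : ℕ, Fin (n + 1)) → ℕ × ℕ := fun x => (x.1, x.2)
  have he : Function.Injective e := by
    rintro ⟨n, i⟩ ⟨m, j⟩ hij
    obtain ⟨rfl, hij⟩ := Prod.mk.inj hij
    exact congrArg (Sigma.mk n) (Fin.ext hij)
  have hrows := (h.comp_injective he).sigma
  refine Real.not_summable_one_div_natCast ((summable_nat_add_iff 1).1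
    (hrows.of_nonneg_of_le (fun n => by positivity) fun n => ?_))
  have hn : (0 : ℝ) < n + 1 := by positivity
  have hterm (i : Fin (n + 1)) : (((n : ℝ) + 1) ^ 2)⁻¹ ≤ so5dimReal (n, i) ^ (-σ) :=
    calc (((n : ℝ) + 1) ^ 2)⁻¹ = (((n : ℝ) + 1) ^ 4) ^ (-(1 / 2) : ℝ) := by
          rw [← Real.rpow_natCast, ← Real.rpow_natCast, ← Real.rpow_neg hn.le,
            ← Real.rpow_mul hn.le]
          norm_num
      _ ≤ so5dimReal (n, i) ^ (-(1 / 2) : ℝ) :=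
          Real.rpow_le_rpow_of_nonpos (so5dimReal_pos _)
            (so5dimReal_le_pow_four (p := (n, i)) (Nat.lt_succ_iff.1 i.2)) (by norm_num)
      _ ≤ so5dimReal (n, i) ^ (-σ) :=
          Real.rpow_le_rpow_of_exponent_le (one_le_so5dimReal _) (by linarith)
  calc 1 / ((n + 1 : ℕ) : ℝ) = ∑ _i : Fin (n + 1), (((n : ℝ) + 1) ^ 2)⁻¹ := by
        simp only [Finset.sum_const, Finset.card_univ, Fintype.card_fin, nsmul_eq_mul]
        push_cast
        field_simp
    _ ≤ ∑ i : Fin (n + 1), so5dimReal (n, i) ^ (-σ) := Finset.sum_le_sum fun i _ => hterm i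
    _ = _ := (tsum_fintype _).symm

theorem wittenZeta_so5_convergence_and_holomorphy :
    (∀ s : ℂ, Summable (fun p : ℕ × ℕ => ‖so5dim p ^ (-s)‖) ↔ (1:ℝ)/2 < s.re) ∧
      DifferentiableOn ℂ (fun s : ℂ => ∑' p : ℕ × ℕ, so5dim p ^ (-s))
        {s : ℂ | (1:ℝ)/2 < s.re} := by
  constructor
  · intro s
    simp only [norm_so5dim_cpow_neg]
    exact ⟨fun h => not_le.1 fun hs => not_summable_so5dimReal_rpow_neg hs h,
      summable_so5dimReal_rpow_neg⟩
  · intro s hs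
    obtain ⟨σ, hσ, hσs⟩ := exists_between (Set.mem_ofPred.1 hs)
    have hopen : IsOpen {z : ℂ | σ < z.re} := isOpen_lt continuous_const continuous_re
    have hdiff : DifferentiableOn ℂ (fun z : ℂ => ∑' p : ℕ × ℕ, so5dim p ^ (-z))
        {z : ℂ | σ < z.re} := by
      refine differentiableOn_tsum_of_summable_norm (summable_so5dimReal_rpow_neg hσ)
        (fun p => ?_) hopen fun p z hz => ?_
      · have hp : so5dim p ≠ 0 := by
          rw [so5dim_eq_ofReal]
          exact ofReal_ne_zero.2 (so5dimReal_pos p).ne'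
        exact (differentiable_id.neg.const_cpow (Or.inl hp)).differentiableOn
      · rw [norm_so5dim_cpow_neg]
        exact Real.rpow_le_rpow_of_exponent_le (one_le_so5dimReal p) (neg_le_neg (le_of_lt hz))
    exact (hdiff.differentiableAt (hopen.mem_nhds hσs)).differentiableWithinAt
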